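/- Let f : E → ℝ be convex on Q, let z ∈ Q, let g ∈ E* be a subgradient of f at z on Q (i.e. f(y) ≥ f(z) + ⟨g, y − z⟩ for all y ∈ Q), let ĝ ∈ E*, let h > 0, and let x⁺ be a minimizer over Q of x ↦ h⟨ĝ, x − z⟩ + V_z(x). Then for every x ∈ Q: f(z) − f(x) ≤ ⟨g − ĝ, z − x⟩ + (1/h)(V_z(x) − V_{x⁺}(x)) + (h/2)‖ĝ‖_*². -/

import Mathlib

/-- First-order optimality condition for the minimizer of a differentiable function over a
convex set. -/
theorem IsMinOn.hasFDerivAt_sub_nonneg {E : Type*} [NormedAddCommGroup E] [NormedSpace ℝ E]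
    {Q : Set E} (hQ : Convex ℝ Q) {φ : E → ℝ} {φ' : E →L[ℝ] ℝ} {a x : E}
    (hmin : IsMinOn φ Q a) (hφ : HasFDerivAt φ φ' a) (ha : a ∈ Q) (hx : x ∈ Q) :
    0 ≤ φ' (x - a) :=
  hmin.localize.hasFDerivWithinAt_nonneg hφ.hasFDerivWithinAt
    (sub_mem_posTangentConeAt_of_segment_subset (hQ.segment_subset ha hx))

/-- One-step progress inequality for (stochastic) Mirror Descent: if `g` is a
subgradient of the convex function `f` at `z` on `Q`, `ĝ ∈ E*`, `h > 0`, and `x⁺`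
minimizes `x ↦ h⟨ĝ, x − z⟩ + V_z(x)` over `Q`, then for all `x ∈ Q`,
`f(z) − f(x) ≤ ⟨g − ĝ, z − x⟩ + (1/h)(V_z(x) − V_{x⁺}(x)) + (h/2)‖ĝ‖_*²`. -/
theorem smd_one_step_inequality
    {E : Type*} [NormedAddCommGroup E] [NormedSpace ℝ E] [FiniteDimensional ℝ E]
    (Q : Set E) (hQne : Q.Nonempty) (hQcomp : IsCompact Q) (hQconv : Convex ℝ Q)
    (d : E → ℝ) (d' : E → E →L[ℝ] ℝ)
    (hd : ∀ x : E, HasFDerivAt d (d' x) x)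
    (hd_strong : ∀ x ∈ Q, ∀ y ∈ Q,
      d x + d' x (y - x) + (1 / 2) * ‖y - x‖ ^ 2 ≤ d y)
    (V : E → E → ℝ)
    (hV : ∀ z x : E, V z x = d x - d z - d' z (x - z))
    (f : E → ℝ) (hf : ConvexOn ℝ Q f)
    (z : E) (hz : z ∈ Q)
    (g : E →L[ℝ] ℝ) (hg : ∀ y ∈ Q, f z + g (y - z) ≤ f y)
    (ghat : E →L[ℝ] ℝ) (h : ℝ) (hh : 0 < h)
    (xplus : E) (hxplus : xplus ∈ Q)
    (hmin : ∀ x ∈ Q,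
      h * ghat (xplus - z) + V z xplus ≤ h * ghat (x - z) + V z x) :
    ∀ x ∈ Q, f z - f x ≤
      (g - ghat) (z - x) + (1 / h) * (V z x - V xplus x) + (h / 2) * ‖ghat‖ ^ 2 := by
  intro x hx
  have hopt : 0 ≤ (h • ghat + (d' xplus - d' z)) (x - xplus) := by
    refine IsMinOn.hasFDerivAt_sub_nonneg (φ := fun y ↦ h * ghat (y - z) + V z y) hQconv
      (fun y hy ↦ hmin y hy) ?_ hxplus hx
    have hsub : HasFDerivAt (fun y : E ↦ y - z) (ContinuousLinearMap.id ℝ E) xplus :=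
      (hasFDerivAt_id xplus).sub_const z
    simp only [hV]
    exact ((ghat.hasFDerivAt.comp xplus hsub).const_mul h).add
      (((hd xplus).sub_const (d z)).sub ((d' z).hasFDerivAt.comp xplus hsub))
  have hdual : ghat (z - xplus) ≤ ‖ghat‖ * ‖xplus - z‖ := by
    rw [norm_sub_rev]
    exact (le_abs_self _).trans (ghat.le_opNorm _)
  have hstrong := hd_strong z hz xplus hxplus
  have hsubgrad := hg x hx
  have hkey : h * ghat (z - x) ≤ V z x - V xplus x + h ^ 2 / 2 * ‖ghat‖ ^ 2 := by
    have hyoung := sq_nonneg (h * ‖ghat‖ - ‖xplus - z‖)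
    have hscaled := mul_le_mul_of_nonneg_left hdual hh.le
    simp only [hV, add_apply, sub_apply,
      smul_apply, smul_eq_mul, map_sub] at *
    linarith
  have hdiv : ghat (z - x) ≤ 1 / h * (V z x - V xplus x) + h / 2 * ‖ghat‖ ^ 2 := by
    refine le_of_mul_le_mul_left (hkey.trans_eq ?_) hh
    field_simp
  simp only [sub_apply, map_sub] at *
  linarith
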